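/- For all positive integers m and n there exists a bijection A ↦ (S,U) from the set of all m×n ℙ-matrices onto the set of all pairs (S,U) of the same shape λ (λ ranging over all partitions), where S is a marked tableau with entries among {1',1,2',2,…,n',n} and U is a semistandard tableau with entries among {1,…,m}, such that for every A = (a_{ij}): Σ_{i=1}^m |a_{ij}| = m_j(S) for each 1 ≤ j ≤ n, Σ_{j=1}^n |a_{ij}| = m_i(U) for each 1 ≤ i ≤ m, and mark(A) = mark(S). (Generalized RSK correspondence.) -/

import Mathlib

open scoped BigOperators

/-- An entry of a `ℙ`-matrix: either `0` or a letter `k` / `k'` (`k ≥ 1`),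
marked (`k'`) when the Bool is `true`. -/
inductive PEnt : Type where
  | zero : PEnt
  | letter : ℕ+ → Bool → PEnt
deriving DecidableEq

/-- `|a|`: the absolute value of an entry. -/
def PEnt.abs : PEnt → ℕ
  | .zero => 0
  | .letter k _ => k

/-- Whether an entry is marked. -/
def PEnt.isMarked : PEnt → Bool
  | .letter _ b => b
  | .zero => false

/-- `mark(A)`: number of marked entries of the matrix `A`. -/
def markMatrix {m n : ℕ} (A : Fin m → Fin n → PEnt) : ℕ :=
  (Finset.univ.filter fun p : Fin m × Fin n => (A p.1 p.2).isMarked = true).card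

/-- A marked tableau of shape `μ`.  Letters of `ℙ` are encoded as positive naturals:
the unmarked letter `k` as `2k` (even) and the marked letter `k'` as `2k - 1` (odd),
so the order `1' < 1 < 2' < 2 < ⋯` on `ℙ` becomes the usual order on codes.
Entries weakly increase along rows and down columns; each row contains at most one `k'`
(equal codes in a row are even) and each column contains at most one `k`
(equal codes in a column are odd).  Cells outside `μ` carry the junk value `0`. -/
structure MarkedTableau (μ : YoungDiagram) where
  val : ℕ → ℕ → ℕ
  pos : ∀ i j, (i, j) ∈ μ → 1 ≤ val i j
  zeros : ∀ i j, (i, j) ∉ μ → val i j = 0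
  rowWeak : ∀ i j1 j2, j1 ≤ j2 → (i, j2) ∈ μ → val i j1 ≤ val i j2
  colWeak : ∀ i1 i2 j, i1 ≤ i2 → (i2, j) ∈ μ → val i1 j ≤ val i2 j
  rowMarked : ∀ i j1 j2, j1 < j2 → (i, j2) ∈ μ → val i j1 = val i j2 → val i j2 % 2 = 0
  colUnmarked : ∀ i1 i2 j, i1 < i2 → (i2, j) ∈ μ → val i1 j = val i2 j → val i2 j % 2 = 1

/-- `m_k(T)`: the number of entries of `T` equal to `k` or `k'`. -/
def mcount {μ : YoungDiagram} (T : MarkedTableau μ) (k : ℕ) : ℕ :=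
  (μ.cells.filter fun c => T.val c.1 c.2 = 2 * k - 1 ∨ T.val c.1 c.2 = 2 * k).card

/-- `mark(T)`: the number of marked entries (odd codes) of `T`. -/
def markTab {μ : YoungDiagram} (T : MarkedTableau μ) : ℕ :=
  (μ.cells.filter fun c => T.val c.1 c.2 % 2 = 1).card

/-- A pair `(S, U)` of tableaux of the same shape, where `S` is a marked tableau with
entries among `{1', 1, …, n', n}` and `U` is a semistandard (i.e. unmarked) tableau with
entries among `{1, …, m}`. -/
structure RSKPair (m n : ℕ) where
  shape : YoungDiagram
  S : MarkedTableau shape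
  U : MarkedTableau shape
  hS : ∀ i j, (i, j) ∈ shape → S.val i j ≤ 2 * n
  hU : ∀ i j, (i, j) ∈ shape → U.val i j % 2 = 0 ∧ U.val i j ≤ 2 * m

/-! ### Strips and the local rule of a growth diagram -/

/-- `ν / α` is a vertical strip (`b = true`) or a horizontal strip (`b = false`), where partitions
are given by their sequences of row lengths. -/
def Strip (b : Bool) (α ν : ℕ → ℕ) : Prop :=
  ∀ k, α k ≤ ν k ∧ (b = true → ν k ≤ α k + 1) ∧ (b = false → ν (k + 1) ≤ α k)

/-- The local rule on a square with corners `κ ⊆ α, β ⊆ ν` and label `a`; the sequence `x` records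
the amount carried into each row. -/
def Cell (b : Bool) (κ α β ν : ℕ → ℕ) (a : ℕ) : Prop :=
  ∃ x : ℕ → ℕ, x 0 = a ∧ ∀ k,
    ((b = true ∧ α k < β k) → ν k = β k ∧ κ k = α k ∧ x (k + 1) = x k) ∧
    (¬(b = true ∧ α k < β k) →
      ν k = max (α k) (β k) + x k ∧ κ k + x (k + 1) = min (α k) (β k))

lemma Strip.le {b : Bool} {α ν : ℕ → ℕ} (h : Strip b α ν) (k : ℕ) : α k ≤ ν k := (h k).1

lemma Strip.antitone_right {α ν : ℕ → ℕ} (h : Strip false α ν) : Antitone ν :=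
  antitone_nat_of_succ_le fun k => ((h k).2.2 rfl).trans (h k).1

lemma Strip.antitone_left {α ν : ℕ → ℕ} (h : Strip false α ν) : Antitone α :=
  antitone_nat_of_succ_le fun k => (h (k + 1)).1.trans ((h k).2.2 rfl)

lemma exists_cell_of_lower {b : Bool} {κ α β : ℕ → ℕ} {a : ℕ} (hα : Strip false κ α)
    (hβ : Strip b κ β) (aβ : Antitone β) (ha : b = true → a ≤ 1) :
    ∃ ν, Cell b κ α β ν a ∧ Strip false β ν ∧ Strip b α ν := by
  classical
  let x : ℕ → ℕ := fun k => Nat.rec a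
    (fun k y => if b = true ∧ α k < β k then y else min (α k) (β k) - κ k) k
  have x0 : x 0 = a := rfl
  have xs : ∀ k, x (k + 1) = if b = true ∧ α k < β k then x k else min (α k) (β k) - κ k :=
    fun k => rfl
  clear_value x
  have aα := hα.antitone_right
  refine ⟨fun k => if b = true ∧ α k < β k then β k else max (α k) (β k) + x k,
    ⟨x, x0, fun k => ⟨fun h => ?_, fun h => ?_⟩⟩, ?_⟩
  · have h1 := hα k
    have h2 := hβ k
    have h3 := h2.2.1 h.1
    beta_reduce
    rw [xs, if_pos h, if_pos h]
    exact ⟨rfl, by omega, rfl⟩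
  · have h1 := hα k
    have h2 := hβ k
    beta_reduce
    rw [xs, if_neg h, if_neg h]
    omega
  · cases b with
    | false =>
      simp only [Bool.false_eq_true, false_and, if_false] at xs ⊢
      constructor <;> intro k <;> have h1 := hα k <;> have h2 := hβ k <;>
        have h3 := h1.2.2 rfl <;> have h4 := h2.2.2 rfl <;> have h5 := xs k <;> simp <;> omega
    | true =>
      simp only [true_and] at xs ⊢
      have hx : ∀ k, x k ≤ 1 := by
        intro k
        induction k with
        | zero => rw [x0]; exact ha rfl
        | succ k ih =>
          have h2 := (hβ k).2.1 rfl
          rw [xs]; split_ifs <;> omega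
      constructor <;> intro k <;> have h1 := hα k <;> have h2 := hβ k <;>
        have h3 := h1.2.2 rfl <;> have h4 := h2.2.1 rfl <;> have h5 := xs k <;>
        have h6 := hx k <;> have h7 := aβ (Nat.le_succ k) <;> have h8 := aα (Nat.le_succ k) <;>
        simp at h7 h8 ⊢ <;>
        split_ifs at h5 ⊢ <;> omega

/-- Backward solution of the recursion for the carries. -/
lemma exists_backward_carry (p : ℕ → Prop) (g : ℕ → ℕ) (L : ℕ) (hp : ∀ k, L ≤ k → ¬ p k) :
    ∃ x : ℕ → ℕ, ∀ k, (p k → x k = x (k + 1)) ∧ (¬ p k → x k = g k) ∧ ∃ j, x k = g j := by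
  classical
  have ex : ∀ k, ∃ j, k ≤ j ∧ ¬ p j := fun k =>
    ⟨max k L, le_max_left _ _, hp _ (le_max_right _ _)⟩
  refine ⟨fun k => g (Nat.find (ex k)), fun k => ⟨fun h => ?_, fun h => ?_, _, rfl⟩⟩
  · refine congrArg g ?_
    refine le_antisymm (Nat.find_min' _ ?_) (Nat.find_min' _ ?_)
    · obtain ⟨h1, h2⟩ := Nat.find_spec (ex (k + 1))
      exact ⟨by omega, h2⟩
    · obtain ⟨h1, h2⟩ := Nat.find_spec (ex k)
      refine ⟨Nat.succ_le_of_lt (lt_of_le_of_ne h1 ?_), h2⟩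
      intro e
      exact h2 (e ▸ h)
  · refine congrArg g ?_
    exact le_antisymm (Nat.find_min' _ ⟨le_rfl, h⟩) (Nat.find_spec (ex k)).1

lemma exists_cell_of_upper {b : Bool} {α β ν : ℕ → ℕ} {L : ℕ} (hβ : Strip false β ν)
    (hα : Strip b α ν) (aα : Antitone α) (hL : ∀ k, L ≤ k → β k = 0) :
    ∃ κ a, Cell b κ α β ν a ∧ Strip false κ α ∧ Strip b κ β ∧ (b = true → a ≤ 1) := by
  classical
  obtain ⟨x, hx⟩ := exists_backward_carry (fun k => b = true ∧ α k < β k)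
    (fun k => ν k - max (α k) (β k)) L (fun k hk h => by have := hL k hk; omega)
  have aβ := hβ.antitone_left
  refine ⟨fun k => if b = true ∧ α k < β k then α k else min (α k) (β k) - x (k + 1), x 0,
    ⟨x, rfl, fun k => ⟨fun h => ?_, fun h => ?_⟩⟩, ?_⟩
  · have h1 := hα k
    have h2 := hβ k
    have h3 := h1.2.1 h.1
    beta_reduce
    rw [if_pos h]
    exact ⟨by omega, rfl, ((hx k).1 h).symm⟩
  · have h1 := hα k
    have h2 := hβ k
    have h3 := h2.2.2 rfl
    have h4 := (hx k).2.1 h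
    beta_reduce
    rw [if_neg h]
    refine ⟨by omega, Nat.sub_add_cancel ?_⟩
    cases b with
    | false =>
      have h5 := (hx (k + 1)).2.1 (by simp)
      have h6 := h1.2.2 rfl
      omega
    | true =>
      have h6 := h1.2.1 rfl
      obtain ⟨j, hj⟩ := (hx (k + 1)).2.2
      have h8 := (hα j).2.1 rfl
      have h9 := (hx (k + 1)).2.1
      have h10 := aα (Nat.le_succ k)
      have h11 := aβ (Nat.le_succ k)
      simp only [true_and, not_lt] at h h9
      simp only [Nat.succ_eq_add_one] at h10 h11
      omega
  · cases b with
    | false =>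
      simp only [Bool.false_eq_true, false_and, if_false, not_false_eq_true, true_implies] at hx ⊢
      refine ⟨?_, ?_, by simp⟩ <;> intro k <;> have h1 := hα k <;> have h2 := hβ k <;>
        have h3 := h1.2.2 rfl <;> have h4 := h2.2.2 rfl <;> have h5 := (hx (k + 1)).2.1 <;>
        have h6 := hα (k + 1) <;> have h7 := hβ (k + 1) <;> simp <;> omega
    | true =>
      simp only [true_and] at hx ⊢
      have hx1 : ∀ k, x k ≤ 1 := by
        intro k
        obtain ⟨j, hj⟩ := (hx k).2.2
        have h8 := (hα j).2.1 rfl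
        omega
      refine ⟨?_, ?_, fun _ => hx1 0⟩ <;> intro k <;> have h1 := hα k <;> have h2 := hβ k <;>
        have h3 := h1.2.1 rfl <;> have h4 := h2.2.2 rfl <;> have h5 := (hx (k + 1)).2.1 <;>
        have h6 := hα (k + 1) <;> have h7 := hβ (k + 1) <;> have h8 := hx1 (k + 1) <;>
        have h10 := aα (Nat.le_succ k) <;> have h11 := aβ (Nat.le_succ k) <;>
        simp at h10 h11 ⊢ <;> split_ifs <;> omega

lemma Cell.upper_unique {b : Bool} {κ α β ν ν' : ℕ → ℕ} {a : ℕ} (h : Cell b κ α β ν a)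
    (h' : Cell b κ α β ν' a) : ν = ν' := by
  obtain ⟨x, x0, hx⟩ := h
  obtain ⟨y, y0, hy⟩ := h'
  have key : ∀ k, x k = y k := by
    intro k
    induction k with
    | zero => rw [x0, y0]
    | succ k ih =>
      have h1 := hx k
      have h2 := hy k
      by_cases hb : b = true ∧ α k < β k
      · have := h1.1 hb; have := h2.1 hb; omega
      · have := h1.2 hb; have := h2.2 hb; omega
  funext k
  have h1 := hx k
  have h2 := hy k
  have h3 := key k
  by_cases hb : b = true ∧ α k < β k
  · have := h1.1 hb; have := h2.1 hb; omega
  · have := h1.2 hb; have := h2.2 hb; omega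

lemma Cell.lower_unique {b : Bool} {κ κ' α β ν : ℕ → ℕ} {a a' L : ℕ} (h : Cell b κ α β ν a)
    (h' : Cell b κ' α β ν a') (hL : ∀ k, L ≤ k → β k = 0) : κ = κ' ∧ a = a' := by
  obtain ⟨x, x0, hx⟩ := h
  obtain ⟨y, y0, hy⟩ := h'
  have step : ∀ k, x (k + 1) = y (k + 1) → x k = y k ∧ κ k = κ' k := by
    intro k h3
    have h1 := hx k
    have h2 := hy k
    by_cases hb : b = true ∧ α k < β k
    · have := h1.1 hb; have := h2.1 hb; omega
    · have := h1.2 hb; have := h2.2 hb; omega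
  have large : ∀ k, L ≤ k → x (k + 1) = y (k + 1) := by
    intro k hk
    have h0 := hL k hk
    have hb : ¬(b = true ∧ α k < β k) := by omega
    have := (hx k).2 hb; have := (hy k).2 hb; omega
  have key : ∀ d k, L ≤ k + d → x (k + 1) = y (k + 1) := by
    intro d
    induction d with
    | zero => exact large
    | succ d ih => exact fun k hk => (step _ (ih (k + 1) (by omega))).1
  have key' : ∀ k, x (k + 1) = y (k + 1) := fun k => key L k (by omega)
  exact ⟨funext fun k => (step k (key' k)).2, by rw [← x0, ← y0]; exact (step 0 (key' 0)).1⟩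

lemma Cell.sum_add_sum {b : Bool} {κ α β ν : ℕ → ℕ} {a L : ℕ} (h : Cell b κ α β ν a)
    (hL : β L = 0) :
    ∑ k ∈ Finset.range (L + 1), ν k + ∑ k ∈ Finset.range (L + 1), κ k =
      ∑ k ∈ Finset.range (L + 1), α k + ∑ k ∈ Finset.range (L + 1), β k + a := by
  obtain ⟨x, x0, hx⟩ := h
  have key : ∀ n, ∑ k ∈ Finset.range n, ν k + ∑ k ∈ Finset.range n, κ k + x n =
      ∑ k ∈ Finset.range n, α k + ∑ k ∈ Finset.range n, β k + a := by
    intro n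
    induction n with
    | zero => simp [x0]
    | succ n ih =>
      simp only [Finset.sum_range_succ]
      have h1 := hx n
      by_cases hb : b = true ∧ α n < β n
      · have := h1.1 hb; omega
      · have := h1.2 hb; omega
  have h1 := (hx L).2 (by omega)
  have h2 := key (L + 1)
  omega

/-! ### Growth diagrams -/

/-- The step from code `c` to code `c + 1` adds marked letters exactly when `c` is even. -/
def markedStep (c : ℕ) : Bool := decide (c % 2 = 0)

/-- `G` is a growth diagram on `[0, m] × [0, N]` with empty left and bottom borders and with
square labels `a`. -/
structure IsGrowth (m N : ℕ) (a : ℕ → ℕ → ℕ) (G : ℕ → ℕ → ℕ → ℕ) : Prop where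
  bot : ∀ j ≤ N, G 0 j = 0
  left : ∀ i ≤ m, G i 0 = 0
  cell : ∀ i < m, ∀ j < N,
    Cell (markedStep j) (G i j) (G (i + 1) j) (G i (j + 1)) (G (i + 1) (j + 1)) (a i j)
  vert : ∀ i < m, ∀ j ≤ N, Strip false (G i j) (G (i + 1) j)
  horiz : ∀ i ≤ m, ∀ j < N, Strip (markedStep j) (G i j) (G i (j + 1))

namespace IsGrowth

variable {m N : ℕ} {a a' : ℕ → ℕ → ℕ} {G G' : ℕ → ℕ → ℕ → ℕ}

lemma antitone (h : IsGrowth m N a G) {i j : ℕ} (hi : i ≤ m) (hj : j ≤ N) : Antitone (G i j) := by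
  cases i with
  | zero => rw [h.bot j hj]; exact antitone_const
  | succ i => exact (h.vert i (by omega) j hj).antitone_right

lemma eq_zero (h : IsGrowth m N a G) {i j : ℕ} (hi : i ≤ m) (hj : j ≤ N) :
    ∀ k, i ≤ k → G i j k = 0 := by
  induction i with
  | zero => intro k _; rw [h.bot j hj]; rfl
  | succ i ih =>
    intro k hk
    obtain ⟨k, rfl⟩ := Nat.exists_eq_add_of_le' (show 1 ≤ k by omega)
    have h1 := (h.vert i (by omega) j hj k).2.2 rfl
    have h2 := ih (by omega) k (by omega)
    omega

/-- The labels determine the growth diagram. -/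
lemma unique_of_labels (h : IsGrowth m N a G) (h' : IsGrowth m N a' G')
    (ha : ∀ i < m, ∀ j < N, a i j = a' i j) : ∀ i ≤ m, ∀ j ≤ N, G i j = G' i j := by
  intro i
  induction i with
  | zero => intro _ j hj; rw [h.bot j hj, h'.bot j hj]
  | succ i ih =>
    intro hi j
    induction j with
    | zero => intro _; rw [h.left _ hi, h'.left _ hi]
    | succ j ihj =>
      intro hj
      have h1 := h.cell i (by omega) j (by omega)
      have h2 := h'.cell i (by omega) j (by omega)
      rw [← ih (by omega) j (by omega), ← ihj (by omega), ← ih (by omega) (j + 1) hj,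
        ← ha i (by omega) j (by omega)] at h2
      exact h1.upper_unique h2

/-- The upper and right borders determine the growth diagram and its labels. -/
lemma unique_of_border (h : IsGrowth m N a G) (h' : IsGrowth m N a' G')
    (hs : ∀ j ≤ N, G m j = G' m j) (hu : ∀ i ≤ m, G i N = G' i N) :
    ∀ i < m, ∀ j < N, a i j = a' i j := by
  have step : ∀ i < m, ∀ j < N, G (i + 1) j = G' (i + 1) j → G i (j + 1) = G' i (j + 1) →
      G (i + 1) (j + 1) = G' (i + 1) (j + 1) → G i j = G' i j ∧ a i j = a' i j := by
    intro i hi j hj h1 h2 h3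
    have c := h.cell i hi j hj
    have c' := h'.cell i hi j hj
    rw [← h1, ← h2, ← h3] at c'
    exact c.lower_unique c' (h.eq_zero hi.le hj)
  have key : ∀ d, ∀ i ≤ m, i + d = m → ∀ e, ∀ j ≤ N, j + e = N → G i j = G' i j := by
    intro d
    induction d with
    | zero => rintro i - rfl e j hj -; exact hs j hj
    | succ d ih =>
      intro i hi hid e
      induction e with
      | zero => rintro j - rfl; exact hu i hi
      | succ e ihe =>
        intro j hj hje
        exact (step i (by omega) j (by omega)
          (ih (i + 1) (by omega) (by omega) _ j hj hje)
          (ihe (j + 1) (by omega) (by omega))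
          (ih (i + 1) (by omega) (by omega) e (j + 1) (by omega) (by omega))).1
  have key' : ∀ i ≤ m, ∀ j ≤ N, G i j = G' i j := fun i hi j hj =>
    key (m - i) i hi (by omega) (N - j) j hj (by omega)
  exact fun i hi j hj => (step i hi j hj (key' _ (by omega) _ (by omega))
    (key' _ (by omega) _ (by omega)) (key' _ (by omega) _ (by omega))).2

lemma sum_eq (h : IsGrowth m N a G) : ∀ i ≤ m, ∀ j ≤ N,
    ∑ k ∈ Finset.range (m + 1), G i j k =
      ∑ p ∈ Finset.range i, ∑ q ∈ Finset.range j, a p q := by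
  intro i
  induction i with
  | zero => intro _ j hj; simp [h.bot j hj]
  | succ i ih =>
    intro hi j
    induction j with
    | zero => intro _; simp [h.left _ hi]
    | succ j ihj =>
      intro hj
      have h1 := (h.cell i hi j hj).sum_add_sum (h.eq_zero (by omega) hj m (by omega))
      rw [ih (by omega) j (by omega), ih (by omega) _ hj, ihj (by omega)] at h1
      simp only [Finset.sum_range_succ, Finset.sum_add_distrib] at h1 ⊢
      omega

end IsGrowth

/-- The upper corner determined by the local rule, when it exists. -/
noncomputable def cellUpper (b : Bool) (κ α β : ℕ → ℕ) (a : ℕ) : ℕ → ℕ :=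
  open Classical in
  if h : ∃ ν, Cell b κ α β ν a ∧ Strip false β ν ∧ Strip b α ν then h.choose else 0

/-- The growth diagram with prescribed labels. -/
noncomputable def growth (a : ℕ → ℕ → ℕ) : ℕ → ℕ → ℕ → ℕ
  | 0, _ => 0
  | _ + 1, 0 => 0
  | i + 1, j + 1 =>
    cellUpper (markedStep j) (growth a i j) (growth a (i + 1) j) (growth a i (j + 1)) (a i j)
termination_by i j => (i, j)

lemma isGrowth_growth {a : ℕ → ℕ → ℕ} (ha : ∀ i j, markedStep j = true → a i j ≤ 1) (m N : ℕ) :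
    IsGrowth m N a (growth a) := by
  have bot : ∀ j, growth a 0 j = 0 := fun j => by rw [growth]
  have left : ∀ i, growth a i 0 = 0 := fun i => by cases i <;> rw [growth]
  have zero : ∀ b, Strip b 0 0 := fun b k => by simp
  have main : ∀ i, (∀ j, Strip (markedStep j) (growth a i j) (growth a i (j + 1))) →
      (∀ j, Antitone (growth a i j)) → ∀ j, Strip false (growth a i j) (growth a (i + 1) j) ∧
      Strip (markedStep j) (growth a (i + 1) j) (growth a (i + 1) (j + 1)) ∧
      Cell (markedStep j) (growth a i j) (growth a (i + 1) j) (growth a i (j + 1))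
        (growth a (i + 1) (j + 1)) (a i j) := by
    intro i h1 h2
    have step : ∀ j, Strip false (growth a i j) (growth a (i + 1) j) →
        Cell (markedStep j) (growth a i j) (growth a (i + 1) j) (growth a i (j + 1))
          (growth a (i + 1) (j + 1)) (a i j) ∧
        Strip false (growth a i (j + 1)) (growth a (i + 1) (j + 1)) ∧
        Strip (markedStep j) (growth a (i + 1) j) (growth a (i + 1) (j + 1)) := by
      intro j hj
      have ex := exists_cell_of_lower hj (h1 j) (h2 (j + 1)) (ha i j)
      have e : growth a (i + 1) (j + 1) = ex.choose := by
        rw [growth, cellUpper, dif_pos ex]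
      rw [e]
      exact ex.choose_spec
    have vert : ∀ j, Strip false (growth a i j) (growth a (i + 1) j) := by
      intro j
      induction j with
      | zero => rw [left, left]; exact zero _
      | succ j ih => exact (step j ih).2.1
    exact fun j => ⟨vert j, (step j (vert j)).2.2, (step j (vert j)).1⟩
  have row : ∀ i, (∀ j, Strip (markedStep j) (growth a i j) (growth a i (j + 1))) ∧
      (∀ j, Antitone (growth a i j)) := by
    intro i
    induction i with
    | zero => simp only [bot]; exact ⟨fun _ => zero _, fun _ => antitone_const⟩
    | succ i ih =>
      have h := main i ih.1 ih.2
      exact ⟨fun j => (h j).2.1, fun j => (h j).1.antitone_right⟩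
  have cell := fun i => main i (row i).1 (row i).2
  exact ⟨fun j _ => bot j, fun i _ => left i, fun i _ j _ => (cell i j).2.2,
    fun i _ j _ => (cell i j).1, fun i _ j _ => (row i).1 j⟩

lemma Strip.mono_range {N : ℕ} {s : ℕ → ℕ → ℕ}
    (h : ∀ c < N, ∃ b, Strip b (s c) (s (c + 1))) {c d : ℕ} (hcd : c ≤ d) (hd : d ≤ N) (k : ℕ) :
    s c k ≤ s d k := by
  induction d, hcd using Nat.le_induction with
  | base => exact le_rfl
  | succ d _ ih =>
    obtain ⟨b, hb⟩ := h d hd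
    exact (ih (by omega)).trans (hb.le k)

lemma exists_row_below {L : ℕ} (N : ℕ) (s : ℕ → ℕ → ℕ) (p : ℕ → ℕ)
    (hs : ∀ j < N, Strip (markedStep j) (s j) (s (j + 1))) (anti : ∀ j ≤ N, Antitone (s j))
    (hL : ∀ j ≤ N, ∀ k, L ≤ k → s j k = 0) (hp : Strip false p (s N)) :
    ∃ (t : ℕ → ℕ → ℕ) (a : ℕ → ℕ), t N = p ∧ (∀ j ≤ N, Strip false (t j) (s j)) ∧
      (∀ j < N, Strip (markedStep j) (t j) (t (j + 1)) ∧
        Cell (markedStep j) (t j) (s j) (t (j + 1)) (s (j + 1)) (a j)) ∧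
      ∀ j, markedStep j = true → a j ≤ 1 := by
  induction N generalizing p with
  | zero =>
    refine ⟨fun _ => p, fun _ => 0, rfl, ?_, by simp, by simp⟩
    intro j hj
    obtain rfl : j = 0 := by omega
    exact hp
  | succ N ih =>
    obtain ⟨κ, z, h1, h2, h3, h4⟩ := exists_cell_of_upper hp (hs N (by omega))
      (anti N (by omega)) (L := L)
      (fun k hk => by have := hp.le k; have := hL (N + 1) le_rfl k hk; omega)
    obtain ⟨t, a, rfl, h5, h6, h7⟩ := ih κ (fun j hj => hs j (by omega))
      (fun j hj => anti j (by omega)) (fun j hj => hL j (by omega)) h2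
    refine ⟨fun j => if j ≤ N then t j else p, fun j => if j < N then a j else
      if j = N then z else 0, by simp, ?_, ?_, ?_⟩
    · intro j hj
      by_cases h : j ≤ N
      · simpa [h] using h5 j h
      · obtain rfl : j = N + 1 := by omega
        simpa using hp
    · intro j hj
      by_cases h : j < N
      · have := h6 j h
        simpa [h, h.le, Nat.succ_le_of_lt h] using this
      · obtain rfl : j = N := by omega
        simpa using ⟨h3, h1⟩
    · intro j hj
      by_cases h : j < N
      · simpa [h] using h7 j hj
      · by_cases e : j = N
        · subst e; simpa using h4 hj
        · simp [h, e]

/-- Every compatible pair of borders bounds a growth diagram. -/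
lemma exists_growth_of_border {L : ℕ} (m N : ℕ) (s u : ℕ → ℕ → ℕ) (hs0 : s 0 = 0) (hu0 : u 0 = 0)
    (hsu : s N = u m) (hs : ∀ j < N, Strip (markedStep j) (s j) (s (j + 1)))
    (anti : ∀ j ≤ N, Antitone (s j)) (hL : ∀ j ≤ N, ∀ k, L ≤ k → s j k = 0)
    (hu : ∀ i < m, Strip false (u i) (u (i + 1))) :
    ∃ a G, IsGrowth m N a G ∧ (∀ j ≤ N, G m j = s j) ∧ (∀ i ≤ m, G i N = u i) ∧
      ∀ i j, markedStep j = true → a i j ≤ 1 := by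
  induction m generalizing s with
  | zero =>
    have h0 : ∀ j ≤ N, s j = 0 := by
      intro j hj
      funext k
      have := Strip.mono_range (fun c hc => ⟨_, hs c hc⟩) hj le_rfl k
      rw [hsu, hu0] at this
      simpa using this
    refine ⟨fun _ _ => 0, fun _ j => s j, ⟨h0, fun _ _ => hs0, by simp, by simp,
      fun _ _ => hs⟩, fun _ _ => rfl, fun i hi => ?_, by simp⟩
    obtain rfl : i = 0 := by omega
    exact hsu
  | succ m ih =>
    obtain ⟨t, z, h1, h2, h3, h4⟩ := exists_row_below N s (u m) hs anti hL
      (hsu ▸ hu m (by omega))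
    obtain ⟨a, G, hG, h5, h6, h7⟩ := ih t
      (by funext k; have := (h2 0 (by omega)).le k; rw [hs0] at this; simpa using this) h1
      (fun j hj => (h3 j hj).1) (fun j hj => (h2 j hj).antitone_left)
      (fun j hj k hk => by have := (h2 j hj).le k; have := hL j hj k hk; omega)
      (fun i hi => hu i (by omega))
    refine ⟨fun i j => if i < m then a i j else z j, fun i j => if i ≤ m then G i j else s j,
      ⟨?_, ?_, ?_, ?_, ?_⟩, ?_, ?_, ?_⟩
    · intro j hj; simpa using hG.bot j hj
    · intro i hi
      by_cases h : i ≤ m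
      · simpa [h] using hG.left i h
      · simpa [h] using hs0
    · intro i hi j hj
      by_cases h : i < m
      · simpa [h, h.le, Nat.succ_le_of_lt h] using hG.cell i h j hj
      · obtain rfl : i = m := by omega
        have := (h3 j hj).2
        simpa [h5 j hj.le, h5 (j + 1) hj] using this
    · intro i hi j hj
      by_cases h : i < m
      · simpa [h, h.le, Nat.succ_le_of_lt h] using hG.vert i h j hj
      · obtain rfl : i = m := by omega
        simpa [h5 j hj] using h2 j hj
    · intro i hi j hj
      by_cases h : i ≤ m
      · simpa [h] using hG.horiz i h j hj
      · simpa [h] using hs j hj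
    · intro j _; simp
    · intro i hi
      by_cases h : i ≤ m
      · simpa [h] using h6 i h
      · obtain rfl : i = m + 1 := by omega
        simpa using hsu
    · intro i j hj
      by_cases h : i < m
      · simpa [h] using h7 i j hj
      · simpa [h] using h4 j hj

/-! ### Marked tableaux as chains of strips -/

/-- A chain of partitions starting at `∅` whose steps are alternately vertical and horizontal
strips. -/
structure StripChain (N : ℕ) (s : ℕ → ℕ → ℕ) : Prop where
  zero : s 0 = 0
  strip : ∀ c < N, Strip (markedStep c) (s c) (s (c + 1))
  anti : ∀ c ≤ N, Antitone (s c)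

/-- The Young diagram with row lengths `f`. -/
def diagramOfRows (f : ℕ → ℕ) (hf : Antitone f) (L : ℕ) (_hL : ∀ k, L ≤ k → f k = 0) :
    YoungDiagram where
  cells := (Finset.range L ×ˢ Finset.range (f 0)).filter fun p => p.2 < f p.1
  isLowerSet := by
    rintro ⟨i, j⟩ ⟨i', j'⟩ ⟨hi, hj⟩ h
    simp only [Finset.coe_filter, Finset.mem_product, Finset.mem_range, Set.mem_ofPred_eq] at h ⊢
    have h1 := hf hi
    simp only at h1 hi hj
    omega

lemma mem_diagramOfRows {f : ℕ → ℕ} {hf : Antitone f} {L : ℕ} {hL : ∀ k, L ≤ k → f k = 0}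
    {i j : ℕ} : (i, j) ∈ diagramOfRows f hf L hL ↔ j < f i := by
  rw [← YoungDiagram.mem_cells]
  simp only [diagramOfRows, Finset.mem_filter, Finset.mem_product, Finset.mem_range,
    and_iff_right_iff_imp]
  intro h
  have h1 := hf (Nat.zero_le i)
  have h2 := hL i
  omega

/-- The index at which the cell `(i, j)` joins the chain `s` (junk value `0` if it does not). -/
noncomputable def joinIndex (N : ℕ) (s : ℕ → ℕ → ℕ) (i j : ℕ) : ℕ :=
  sInf {c | c ≤ N ∧ j < s c i}

lemma joinIndex_eq_zero {N : ℕ} {s : ℕ → ℕ → ℕ} {i j : ℕ} (h : ∀ c ≤ N, ¬ j < s c i) :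
    joinIndex N s i j = 0 := by
  rw [joinIndex, Nat.sInf_eq_zero]
  exact Or.inr (Set.eq_empty_of_forall_notMem fun c hc => h c hc.1 hc.2)

namespace StripChain

variable {N : ℕ} {s : ℕ → ℕ → ℕ}

lemma mono (h : StripChain N s) {c d : ℕ} (hcd : c ≤ d) (hd : d ≤ N) (k : ℕ) : s c k ≤ s d k :=
  Strip.mono_range (fun c hc => ⟨_, h.strip c hc⟩) hcd hd k

lemma joinIndex_spec {i j : ℕ} (hj : j < s N i) :
    joinIndex N s i j ≤ N ∧ j < s (joinIndex N s i j) i :=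
  Nat.sInf_mem (s := {c | c ≤ N ∧ j < s c i}) ⟨N, le_rfl, hj⟩

lemma joinIndex_le_iff (h : StripChain N s) {i j c : ℕ} (hj : j < s N i) (hc : c ≤ N) :
    joinIndex N s i j ≤ c ↔ j < s c i :=
  ⟨fun h1 => (joinIndex_spec hj).2.trans_le (h.mono h1 hc i), fun h1 => Nat.sInf_le ⟨hc, h1⟩⟩

lemma exists_joinIndex_eq_succ (h : StripChain N s) {i j : ℕ} (hj : j < s N i) :
    ∃ c < N, joinIndex N s i j = c + 1 ∧ j < s (c + 1) i ∧ ¬ j < s c i := by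
  obtain ⟨h1, h2⟩ := joinIndex_spec hj
  have h3 : joinIndex N s i j ≠ 0 := by
    intro e
    rw [e, h.zero] at h2
    simp at h2
  obtain ⟨c, hc⟩ := Nat.exists_eq_succ_of_ne_zero h3
  refine ⟨c, by omega, hc, by rwa [hc] at h2, ?_⟩
  rw [← h.joinIndex_le_iff hj (by omega)]
  omega

/-- The tableau recording when each cell joins a chain of strips. -/
noncomputable def tableau (h : StripChain N s) (μ : YoungDiagram)
    (hμ : ∀ i j, (i, j) ∈ μ ↔ j < s N i) : MarkedTableau μ where
  val := joinIndex N s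
  pos i j hij := by
    obtain ⟨c, -, hc, -⟩ := h.exists_joinIndex_eq_succ ((hμ i j).1 hij)
    omega
  zeros i j hij := joinIndex_eq_zero fun c hc hj =>
    hij ((hμ i j).2 (hj.trans_le (h.mono hc le_rfl i)))
  rowWeak i j1 j2 hj h2 := by
    have h2' := (hμ _ _).1 h2
    obtain ⟨h3, h4⟩ := joinIndex_spec h2'
    exact (h.joinIndex_le_iff (hj.trans_lt h2') h3).2 (hj.trans_lt h4)
  colWeak i1 i2 j hi h2 := by
    have h2' := (hμ _ _).1 h2
    obtain ⟨h3, h4⟩ := joinIndex_spec h2'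
    exact (h.joinIndex_le_iff (h2'.trans_le (h.anti N le_rfl hi)) h3).2
      (h4.trans_le (h.anti _ h3 hi))
  rowMarked i j1 j2 hj h2 e := by
    have h2' := (hμ _ _).1 h2
    obtain ⟨c, hc, h3, h4, h5⟩ := h.exists_joinIndex_eq_succ h2'
    by_contra hodd
    have h6 := (h.strip c hc i).2.1 (by simp [markedStep]; omega)
    have h7 := (h.joinIndex_le_iff (hj.trans h2') hc.le).2 (by omega)
    omega
  colUnmarked i1 i2 j hi h2 e := by
    have h2' := (hμ _ _).1 h2
    obtain ⟨c, hc, h3, h4, h5⟩ := h.exists_joinIndex_eq_succ h2'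
    by_contra heven
    have h6 := (h.strip c hc i1).2.2 (by simp [markedStep]; omega)
    have h8 := h.anti (c + 1) hc (Nat.succ_le_of_lt hi)
    have h9 := h.anti N le_rfl hi.le
    have h7 := (h.joinIndex_le_iff (i := i1) (j := j) (by omega) hc.le).2
      (by simp only [Nat.succ_eq_add_one] at h8; omega)
    omega

lemma card_val_le (h : StripChain N s) {μ : YoungDiagram} (hμ : ∀ i j, (i, j) ∈ μ ↔ j < s N i)
    {L : ℕ} (hL : ∀ k, L ≤ k → s N k = 0) {c : ℕ} (hc : c ≤ N) :
    (μ.cells.filter fun p => (h.tableau μ hμ).val p.1 p.2 ≤ c).card =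
      ∑ k ∈ Finset.range L, s c k := by
  have e : ∑ k ∈ Finset.range L, s c k =
      ((Finset.range L).sigma fun k => Finset.range (s c k)).card := by
    simp [Finset.card_sigma]
  rw [e]
  refine Finset.card_nbij' (fun p => ⟨p.1, p.2⟩) (fun p => (p.1, p.2)) ?_ ?_ ?_ ?_
  · rintro ⟨i, j⟩ hp
    simp only [Finset.coe_filter, YoungDiagram.mem_cells, Set.mem_ofPred_eq] at hp
    have h1 := (hμ i j).1 hp.1
    have h2 := (h.joinIndex_le_iff h1 hc).1 hp.2
    have h3 := hL i
    simp only [Finset.coe_sigma, Set.mem_sigma_iff, Finset.mem_coe, Finset.mem_range]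
    omega
  · rintro ⟨i, j⟩ hp
    simp only [Finset.coe_sigma, Set.mem_sigma_iff, Finset.mem_coe, Finset.mem_range] at hp
    have h1 := hp.2.trans_le (h.mono hc le_rfl i)
    simp only [Finset.coe_filter, YoungDiagram.mem_cells, Set.mem_ofPred_eq]
    exact ⟨(hμ i j).2 h1, (h.joinIndex_le_iff h1 hc).2 hp.2⟩
  · rintro ⟨i, j⟩ _; rfl
  · rintro ⟨i, j⟩ _; rfl

lemma card_val_eq (h : StripChain N s) {μ : YoungDiagram} (hμ : ∀ i j, (i, j) ∈ μ ↔ j < s N i)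
    {L : ℕ} (hL : ∀ k, L ≤ k → s N k = 0) {c : ℕ} (hc : c < N) :
    (μ.cells.filter fun p => (h.tableau μ hμ).val p.1 p.2 = c + 1).card +
      ∑ k ∈ Finset.range L, s c k = ∑ k ∈ Finset.range L, s (c + 1) k := by
  rw [← h.card_val_le hμ hL hc.le, ← h.card_val_le hμ hL hc, ← Finset.card_union_of_disjoint]
  · congr 1
    ext p
    simp only [Finset.mem_union, Finset.mem_filter]
    constructor
    · rintro (h | h) <;> exact ⟨h.1, by omega⟩
    · rintro ⟨h1, h2⟩
      by_cases h3 : (h.tableau μ hμ).val p.1 p.2 = c + 1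
      · exact Or.inl ⟨h1, h3⟩
      · exact Or.inr ⟨h1, by omega⟩
  · rw [Finset.disjoint_left]
    intro p h1 h2
    simp only [Finset.mem_filter] at h1 h2
    omega

/-- The tableau determines the chain. -/
lemma eq_of_tableau_val_eq {s' : ℕ → ℕ → ℕ} (h : StripChain N s) (h' : StripChain N s')
    {μ μ' : YoungDiagram} (hμ : ∀ i j, (i, j) ∈ μ ↔ j < s N i)
    (hμ' : ∀ i j, (i, j) ∈ μ' ↔ j < s' N i) (e : μ = μ')
    (hv : (h.tableau μ hμ).val = (h'.tableau μ' hμ').val) : ∀ c ≤ N, s c = s' c := by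
  subst e
  intro c hc
  funext i
  refine eq_of_forall_lt_iff fun j => ?_
  by_cases hj : (i, j) ∈ μ
  · have hv' : joinIndex N s i j = joinIndex N s' i j := congrFun (congrFun hv i) j
    rw [← h.joinIndex_le_iff ((hμ i j).1 hj) hc, ← h'.joinIndex_le_iff ((hμ' i j).1 hj) hc, hv']
  · have h1 := h.mono hc le_rfl i
    have h2 := h'.mono hc le_rfl i
    have h3 := mt (hμ i j).2 hj
    have h4 := mt (hμ' i j).2 hj
    omega

end StripChain

namespace MarkedTableau

variable {μ : YoungDiagram} (T : MarkedTableau μ)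

/-- The subdiagram of the cells with code at most `c`. -/
def sub (c : ℕ) : YoungDiagram where
  cells := μ.cells.filter fun p => T.val p.1 p.2 ≤ c
  isLowerSet := by
    rintro ⟨i, j⟩ ⟨i', j'⟩ ⟨hi, hj⟩ h
    simp only [Finset.coe_filter, YoungDiagram.mem_cells, Set.mem_ofPred_eq] at h hi hj ⊢
    have h1 := μ.up_left_mem hi le_rfl h.1
    exact ⟨μ.up_left_mem hi hj h.1,
      (T.rowWeak i' j' j hj h1).trans ((T.colWeak i' i j hi h.1).trans h.2)⟩

lemma lt_rowLen_sub {c i j : ℕ} : j < (T.sub c).rowLen i ↔ (i, j) ∈ μ ∧ T.val i j ≤ c := by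
  rw [← YoungDiagram.mem_iff_lt_rowLen, ← YoungDiagram.mem_cells]
  simp [sub]

lemma stripChain_sub (N : ℕ) : StripChain N fun c => (T.sub c).rowLen where
  zero := by
    funext i
    by_contra h
    have h1 := T.lt_rowLen_sub.1 (Nat.pos_of_ne_zero h)
    have h2 := T.pos _ _ h1.1
    omega
  strip c _ i := by
    refine ⟨le_of_forall_lt fun j hj => ?_, fun hc => ?_, fun hc => le_of_forall_lt fun j hj => ?_⟩
    · rw [lt_rowLen_sub] at hj ⊢
      exact ⟨hj.1, by omega⟩
    · by_contra! hlt
      have h1 := T.lt_rowLen_sub.1 hlt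
      have h2 := T.lt_rowLen_sub.1 ((Nat.lt_succ_self _).trans hlt)
      have h3 := mt T.lt_rowLen_sub.2 (lt_irrefl ((T.sub c).rowLen i))
      have h4 := mt T.lt_rowLen_sub.2 (Nat.lt_succ_self ((T.sub c).rowLen i)).not_gt
      have h5 := mt (And.intro h2.1) h3
      have h6 := mt (And.intro h1.1) h4
      have h7 := T.rowMarked i _ _ (Nat.lt_succ_self _) h1.1
      simp only [markedStep, decide_eq_true_eq, Nat.succ_eq_add_one] at *
      omega
    · rw [lt_rowLen_sub] at hj ⊢
      refine ⟨μ.up_left_mem (Nat.le_succ i) le_rfl hj.1, ?_⟩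
      have h1 := T.colWeak i (i + 1) j (Nat.le_succ i) hj.1
      have h2 := T.colUnmarked i (i + 1) j (Nat.lt_succ_self i) hj.1
      simp only [markedStep, decide_eq_false_iff_not] at hc
      omega
  anti c _ i i' h := (T.sub c).rowLen_anti i i' h

lemma sub_eq_of_le {N : ℕ} (h : ∀ i j, (i, j) ∈ μ → T.val i j ≤ N) : T.sub N = μ := by
  ext ⟨i, j⟩
  simpa [sub] using h i j

lemma joinIndex_sub {N : ℕ} (h : ∀ i j, (i, j) ∈ μ → T.val i j ≤ N) :
    joinIndex N (fun c => (T.sub c).rowLen) = T.val := by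
  funext i j
  by_cases hij : (i, j) ∈ μ
  · have hj : j < (T.sub N).rowLen i := T.lt_rowLen_sub.2 ⟨hij, h i j hij⟩
    refine eq_of_forall_ge_iff fun c => ?_
    by_cases hc : c ≤ N
    · rw [(T.stripChain_sub N).joinIndex_le_iff hj hc, lt_rowLen_sub]
      simp [hij]
    · have h1 := (StripChain.joinIndex_spec (s := fun c => (T.sub c).rowLen) hj).1
      have h2 := h i j hij
      omega
  · rw [T.zeros i j hij]
    exact joinIndex_eq_zero fun c _ hj => hij (T.lt_rowLen_sub.1 hj).1

end MarkedTableau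

/-! ### Labels of a `ℙ`-matrix -/

namespace PEnt

/-- The contribution of an entry to the marked letters. -/
def markedPart (x : PEnt) : ℕ := if x.isMarked then 1 else 0

/-- The contribution of an entry to the unmarked letters. -/
def unmarkedPart (x : PEnt) : ℕ := x.abs - x.markedPart

lemma markedPart_add_unmarkedPart (x : PEnt) : x.markedPart + x.unmarkedPart = x.abs := by
  refine Nat.add_sub_cancel' ?_
  rcases x with _ | ⟨k, b⟩
  · simp [markedPart, isMarked]
  · have := k.pos
    cases b <;> simp [markedPart, isMarked, abs]
    omega

lemma markedPart_le_one (x : PEnt) : x.markedPart ≤ 1 := by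
  rw [markedPart]; split <;> simp

lemma ext_parts {x y : PEnt} (h : x.markedPart = y.markedPart)
    (h' : x.unmarkedPart = y.unmarkedPart) : x = y := by
  have e := x.markedPart_add_unmarkedPart
  rw [h, h', y.markedPart_add_unmarkedPart] at e
  rcases x with _ | ⟨k, b⟩ <;> rcases y with _ | ⟨l, c⟩
  · rfl
  · have := l.pos
    simp only [abs] at e
    omega
  · have := k.pos
    simp only [abs] at e
    omega
  · have : k = l := PNat.coe_injective e.symm
    subst this
    cases b <;> cases c <;> simp [markedPart, isMarked] at h ⊢

lemma exists_parts {e : ℕ} (he : e ≤ 1) (d : ℕ) :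
    ∃ x : PEnt, x.markedPart = e ∧ x.unmarkedPart = d := by
  obtain rfl | rfl : e = 0 ∨ e = 1 := by omega
  · cases d with
    | zero => exact ⟨.zero, rfl, rfl⟩
    | succ d => exact ⟨.letter d.succPNat false, rfl, rfl⟩
  · exact ⟨.letter d.succPNat true, rfl, rfl⟩

end PEnt

section Correspondence

variable {m n : ℕ}

/-- The labels of the growth diagram of a `ℙ`-matrix: column `j` of the matrix gives the columns
`2 * j` (marked part) and `2 * j + 1` (unmarked part). -/
def labels (A : Fin m → Fin n → PEnt) (i c : ℕ) : ℕ :=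
  if h : i < m ∧ c / 2 < n then
    if c % 2 = 0 then (A ⟨i, h.1⟩ ⟨c / 2, h.2⟩).markedPart
    else (A ⟨i, h.1⟩ ⟨c / 2, h.2⟩).unmarkedPart
  else 0

lemma labels_even (A : Fin m → Fin n → PEnt) (i : Fin m) (j : Fin n) :
    labels A i (2 * j) = (A i j).markedPart := by
  simp [labels]

lemma labels_odd (A : Fin m → Fin n → PEnt) (i : Fin m) (j : Fin n) :
    labels A i (2 * j + 1) = (A i j).unmarkedPart := by
  have h : (2 * (j : ℕ) + 1) / 2 = j := by omega
  simp [labels, h, Nat.add_mod]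

lemma labels_le_one (A : Fin m → Fin n → PEnt) (i c : ℕ) (hc : markedStep c = true) :
    labels A i c ≤ 1 := by
  have hc' : c % 2 = 0 := by simpa [markedStep] using hc
  rw [labels]
  split_ifs
  · exact PEnt.markedPart_le_one _
  · simp

lemma ext_labels {A B : Fin m → Fin n → PEnt}
    (h : ∀ i < m, ∀ c < 2 * n, labels A i c = labels B i c) : A = B := by
  funext i j
  have h1 := h i i.2 (2 * j) (by omega)
  have h2 := h i i.2 (2 * j + 1) (by omega)
  rw [labels_even, labels_even] at h1
  rw [labels_odd, labels_odd] at h2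
  exact PEnt.ext_parts h1 h2

lemma exists_labels (a : ℕ → ℕ → ℕ) (ha : ∀ i c, markedStep c = true → a i c ≤ 1) (m n : ℕ) :
    ∃ A : Fin m → Fin n → PEnt, ∀ i < m, ∀ c < 2 * n, labels A i c = a i c := by
  choose A h1 h2 using fun (i : Fin m) (j : Fin n) =>
    PEnt.exists_parts (ha i (2 * j) (by simp [markedStep])) (a i (2 * j + 1))
  refine ⟨A, fun i hi c hc => ?_⟩
  rcases Nat.even_or_odd' c with ⟨j, rfl | rfl⟩
  · rw [← h1 ⟨i, hi⟩ ⟨j, by omega⟩]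
    exact labels_even A ⟨i, hi⟩ ⟨j, by omega⟩
  · rw [← h2 ⟨i, hi⟩ ⟨j, by omega⟩]
    exact labels_odd A ⟨i, hi⟩ ⟨j, by omega⟩

lemma sum_range_two_mul_eq {M : Type*} [AddCommMonoid M] (f : ℕ → M) (n : ℕ) :
    ∑ c ∈ Finset.range (2 * n), f c = ∑ j : Fin n, (f (2 * j) + f (2 * j + 1)) := by
  rw [Fin.sum_univ_eq_sum_range (fun j => f (2 * j) + f (2 * j + 1))]
  induction n with
  | zero => simp
  | succ n ih =>
    rw [Nat.mul_succ, Finset.sum_range_succ, Finset.sum_range_succ, Finset.sum_range_succ, ih,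
      add_assoc]

/-! ### The correspondence -/

lemma IsGrowth.stripChain_top {N : ℕ} {a : ℕ → ℕ → ℕ} {G : ℕ → ℕ → ℕ → ℕ}
    (h : IsGrowth m N a G) : StripChain N (G m) :=
  ⟨h.left m le_rfl, h.horiz m le_rfl, fun _ hc => h.antitone le_rfl hc⟩

lemma IsGrowth.stripChain_right {N : ℕ} {a : ℕ → ℕ → ℕ} {G : ℕ → ℕ → ℕ → ℕ}
    (h : IsGrowth m N a G) : StripChain (2 * m) (fun c => G (c / 2) N) where
  zero := h.bot N le_rfl
  strip c hc := by
    by_cases he : c % 2 = 0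
    · have e : (c + 1) / 2 = c / 2 := by omega
      intro k
      simp [e, markedStep, he]
    · have e : (c + 1) / 2 = c / 2 + 1 := by omega
      have := h.vert (c / 2) (by omega) N le_rfl
      simpa [e, markedStep, he] using this
  anti c hc := h.antitone (by omega) le_rfl

lemma isGrowth_labels (A : Fin m → Fin n → PEnt) :
    IsGrowth m (2 * n) (labels A) (growth (labels A)) :=
  isGrowth_growth (labels_le_one A) m (2 * n)

/-- The common shape of the tableaux attached to a `ℙ`-matrix. -/
noncomputable def rskShape (A : Fin m → Fin n → PEnt) : YoungDiagram :=
  diagramOfRows (growth (labels A) m (2 * n)) ((isGrowth_labels A).antitone le_rfl le_rfl) m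
    ((isGrowth_labels A).eq_zero le_rfl le_rfl)

lemma mem_rskShape_top (A : Fin m → Fin n → PEnt) (i j : ℕ) :
    (i, j) ∈ rskShape A ↔ j < growth (labels A) m (2 * n) i := mem_diagramOfRows

lemma mem_rskShape_right (A : Fin m → Fin n → PEnt) (i j : ℕ) :
    (i, j) ∈ rskShape A ↔ j < growth (labels A) (2 * m / 2) (2 * n) i := by
  rw [mem_rskShape_top, Nat.mul_div_cancel_left m two_pos]

/-- The generalized RSK correspondence. -/
noncomputable def rsk (A : Fin m → Fin n → PEnt) : RSKPair m n where
  shape := rskShape A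
  S := (isGrowth_labels A).stripChain_top.tableau _ (mem_rskShape_top A)
  U := (isGrowth_labels A).stripChain_right.tableau _ (mem_rskShape_right A)
  hS i j hij := (StripChain.joinIndex_spec ((mem_rskShape_top A i j).1 hij)).1
  hU i j hij := by
    obtain ⟨c, hc, h1, h2, h3⟩ := (isGrowth_labels A).stripChain_right.exists_joinIndex_eq_succ
      ((mem_rskShape_right A i j).1 hij)
    have h4 : (c + 1) / 2 ≠ c / 2 := fun e => h3 (e ▸ h2)
    simp only [StripChain.tableau]
    omega

lemma RSKPair.ext_val {p q : RSKPair m n} (h : p.shape = q.shape) (hS : p.S.val = q.S.val)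
    (hU : p.U.val = q.U.val) : p = q := by
  rcases p with ⟨μ, ⟨s⟩, ⟨u⟩⟩
  rcases q with ⟨μ', ⟨s'⟩, ⟨u'⟩⟩
  simp only at h hS hU
  subst h hS hU
  rfl

lemma rsk_injective : Function.Injective (rsk (m := m) (n := n)) := by
  intro A B h
  have hshape : rskShape A = rskShape B := congrArg RSKPair.shape h
  have hS : (rsk A).S.val = (rsk B).S.val := by rw [h]
  have hU : (rsk A).U.val = (rsk B).U.val := by rw [h]
  refine ext_labels ((isGrowth_labels A).unique_of_border (isGrowth_labels B)
    ((isGrowth_labels A).stripChain_top.eq_of_tableau_val_eq (isGrowth_labels B).stripChain_top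
      (mem_rskShape_top A) (mem_rskShape_top B) hshape hS) fun i hi => ?_)
  have := (isGrowth_labels A).stripChain_right.eq_of_tableau_val_eq
    (isGrowth_labels B).stripChain_right
    (mem_rskShape_right A) (mem_rskShape_right B) hshape hU (2 * i) (by omega)
  simpa using this

lemma joinIndex_congr {N : ℕ} {s t : ℕ → ℕ → ℕ} (h : ∀ c ≤ N, s c = t c) :
    joinIndex N s = joinIndex N t := by
  funext i j
  refine congrArg sInf (Set.ext fun c => and_congr_right fun hc => ?_)
  rw [h c hc]

lemma rsk_surjective : Function.Surjective (rsk (m := m) (n := n)) := by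
  intro p
  have hU := fun i j h => (p.hU i j h).2
  have cS := p.S.stripChain_sub (2 * n)
  have cU := p.U.stripChain_sub (2 * m)
  have sub_odd : ∀ i, p.U.sub (2 * i + 1) = p.U.sub (2 * i) := by
    intro i
    ext ⟨k, l⟩
    simp only [MarkedTableau.sub, Finset.mem_filter, YoungDiagram.mem_cells]
    refine and_congr_right fun h => ?_
    have := (p.hU k l h).1
    omega
  have topS : ∀ k, (p.S.sub (2 * n)).rowLen k = p.shape.rowLen k := fun k => by
    rw [p.S.sub_eq_of_le p.hS]
  have topU : ∀ k, (p.U.sub (2 * m)).rowLen k = p.shape.rowLen k := fun k => by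
    rw [p.U.sub_eq_of_le hU]
  obtain ⟨a, G, hG, hs, hu, ha⟩ := exists_growth_of_border (L := p.shape.colLen 0) m (2 * n)
    (fun c => (p.S.sub c).rowLen) (fun i => (p.U.sub (2 * i)).rowLen) cS.zero cU.zero
    (funext fun k => (topS k).trans (topU k).symm) cS.strip cS.anti
    (fun c hc k hk => by
      have h1 : ¬ (k, 0) ∈ p.shape := by rw [YoungDiagram.mem_iff_lt_colLen]; omega
      rw [YoungDiagram.mem_iff_lt_rowLen] at h1
      have h2 := cS.mono hc le_rfl k
      rw [topS] at h2
      omega)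
    (fun i hi => by
      have := cU.strip (2 * i + 1) (by omega)
      simpa [markedStep, Nat.add_mod, sub_odd, Nat.mul_succ] using this)
  obtain ⟨A, hA⟩ := exists_labels a ha m n
  have key := (isGrowth_labels A).unique_of_labels hG hA
  have top : ∀ c ≤ 2 * n, growth (labels A) m c = (p.S.sub c).rowLen := fun c hc =>
    (key m le_rfl c hc).trans (hs c hc)
  have right : ∀ c ≤ 2 * m, growth (labels A) (c / 2) (2 * n) = (p.U.sub c).rowLen := by
    intro c hc
    rw [key _ (by omega) _ le_rfl, hu _ (by omega)]
    rcases Nat.even_or_odd' c with ⟨i, rfl | rfl⟩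
    · simp
    · rw [sub_odd, show (2 * i + 1) / 2 = i by omega]
  refine ⟨A, RSKPair.ext_val ?_ ?_ ?_⟩
  · ext ⟨i, j⟩
    rw [YoungDiagram.mem_cells, YoungDiagram.mem_cells,
      YoungDiagram.mem_iff_lt_rowLen (μ := p.shape), ← topS, ← top _ le_rfl]
    exact mem_rskShape_top A i j
  · exact (joinIndex_congr top).trans (p.S.joinIndex_sub p.hS)
  · exact (joinIndex_congr right).trans (p.U.joinIndex_sub hU)

lemma card_rsk_S (A : Fin m → Fin n → PEnt) {c : ℕ} (hc : c < 2 * n) :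
    ((rsk A).shape.cells.filter fun p => (rsk A).S.val p.1 p.2 = c + 1).card =
      ∑ i : Fin m, labels A i c := by
  have hG := isGrowth_labels A
  have h := hG.stripChain_top.card_val_eq (mem_rskShape_top A) (L := m + 1)
    (fun k hk => hG.eq_zero le_rfl le_rfl k (by omega)) hc
  rw [hG.sum_eq m le_rfl c hc.le, hG.sum_eq m le_rfl (c + 1) hc] at h
  simp only [Finset.sum_range_succ, Finset.sum_add_distrib] at h
  rw [Fin.sum_univ_eq_sum_range (fun i => labels A i c)]
  exact Nat.add_right_cancel (h.trans (add_comm _ _))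

lemma mcount_eq_add {μ : YoungDiagram} (T : MarkedTableau μ) (k : ℕ) :
    mcount T (k + 1) = (μ.cells.filter fun p => T.val p.1 p.2 = 2 * k + 1).card +
      (μ.cells.filter fun p => T.val p.1 p.2 = 2 * k + 1 + 1).card := by
  rw [mcount, ← Finset.card_union_of_disjoint]
  · rw [← Finset.filter_or]
    rfl
  · rw [Finset.disjoint_left]
    intro p h1 h2
    simp only [Finset.mem_filter] at h1 h2
    omega

lemma mcount_rsk_S (A : Fin m → Fin n → PEnt) (j : Fin n) :
    mcount (rsk A).S (j + 1) = ∑ i : Fin m, (A i j).abs := by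
  rw [mcount_eq_add, card_rsk_S A (by omega), card_rsk_S A (by omega), ← Finset.sum_add_distrib]
  refine Finset.sum_congr rfl fun i _ => ?_
  rw [labels_even, labels_odd, PEnt.markedPart_add_unmarkedPart]

lemma mcount_rsk_U (A : Fin m → Fin n → PEnt) (i : Fin m) :
    mcount (rsk A).U (i + 1) = ∑ j : Fin n, (A i j).abs := by
  have hG := isGrowth_labels A
  have hi := i.2
  have hL : ∀ k, m + 1 ≤ k → growth (labels A) (2 * m / 2) (2 * n) k = 0 := fun k hk =>
    hG.eq_zero (by omega) le_rfl k (by omega)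
  have h1 : ((rsk A).shape.cells.filter fun p => (rsk A).U.val p.1 p.2 = 2 * i + 1).card +
      ∑ k ∈ Finset.range (m + 1), growth (labels A) ((2 * i) / 2) (2 * n) k =
      ∑ k ∈ Finset.range (m + 1), growth (labels A) ((2 * i + 1) / 2) (2 * n) k :=
    hG.stripChain_right.card_val_eq (mem_rskShape_right A) (L := m + 1) hL
    (c := 2 * i) (by omega)
  have h2 : ((rsk A).shape.cells.filter fun p => (rsk A).U.val p.1 p.2 = 2 * i + 1 + 1).card +
      ∑ k ∈ Finset.range (m + 1), growth (labels A) ((2 * i + 1) / 2) (2 * n) k =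
      ∑ k ∈ Finset.range (m + 1), growth (labels A) ((2 * i + 1 + 1) / 2) (2 * n) k :=
    hG.stripChain_right.card_val_eq (mem_rskShape_right A) (L := m + 1) hL
    (c := 2 * i + 1) (by omega)
  have e1 : 2 * (i : ℕ) / 2 = i := by omega
  have e2 : (2 * (i : ℕ) + 1) / 2 = i := by omega
  have e3 : (2 * (i : ℕ) + 1 + 1) / 2 = i + 1 := by omega
  simp only [e1, e2, e3] at h1 h2
  rw [hG.sum_eq i hi.le _ le_rfl] at h1
  rw [hG.sum_eq i hi.le _ le_rfl, hG.sum_eq (i + 1) hi _ le_rfl, Finset.sum_range_succ,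
    sum_range_two_mul_eq (labels A i)] at h2
  simp only [labels_even, labels_odd, PEnt.markedPart_add_unmarkedPart] at h2
  rw [mcount_eq_add]
  omega

lemma markTab_rsk (A : Fin m → Fin n → PEnt) : markTab (rsk A).S = markMatrix A := by
  have h : (rsk A).shape.cells.filter (fun p => (rsk A).S.val p.1 p.2 % 2 = 1) =
      Finset.univ.biUnion fun j : Fin n =>
        (rsk A).shape.cells.filter fun p => (rsk A).S.val p.1 p.2 = 2 * j + 1 := by
    ext p
    simp only [Finset.mem_filter, Finset.mem_biUnion, Finset.mem_univ, true_and]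
    constructor
    · rintro ⟨h1, h2⟩
      have h3 := (rsk A).hS p.1 p.2 h1
      exact ⟨⟨(rsk A).S.val p.1 p.2 / 2, by omega⟩, h1, by simp only; omega⟩
    · rintro ⟨j, h1, h2⟩
      exact ⟨h1, by omega⟩
  rw [markTab, h, Finset.card_biUnion]
  · rw [markMatrix, Finset.card_filter, Fintype.sum_prod_type_right]
    refine Finset.sum_congr rfl fun j _ => ?_
    rw [card_rsk_S A (by omega)]
    exact Finset.sum_congr rfl fun i _ => labels_even A i j
  · intro j _ j' _ hne
    refine Finset.disjoint_left.2 fun p h1 h2 => ?_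
    simp only [Finset.mem_filter] at h1 h2
    exact hne (Fin.ext (by omega))

end Correspondence

/-- generalized RSK correspondence: a bijection `A ↦ (S, U)` between
`m × n` `ℙ`-matrices and pairs of tableaux of the same shape as above, with
`Σ_i |a_{ij}| = m_j(S)`, `Σ_j |a_{ij}| = m_i(U)` and `mark(A) = mark(S)`. -/
theorem generalized_RSK (m n : ℕ) (hm : 0 < m) (hn : 0 < n) :
    ∃ Φ : (Fin m → Fin n → PEnt) → RSKPair m n,
      Function.Bijective Φ ∧
      ∀ A : Fin m → Fin n → PEnt,
        (∀ j : Fin n, ∑ i : Fin m, (A i j).abs = mcount (Φ A).S ((j : ℕ) + 1)) ∧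
        (∀ i : Fin m, ∑ j : Fin n, (A i j).abs = mcount (Φ A).U ((i : ℕ) + 1)) ∧
        markMatrix A = markTab (Φ A).S := by
  exact ⟨rsk, ⟨rsk_injective, rsk_surjective⟩, fun A =>
    ⟨fun j => (mcount_rsk_S A j).symm, fun i => (mcount_rsk_U A i).symm, (markTab_rsk A).symm⟩⟩
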